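/- Let α, β ∈ SL₂(ℝ) be the matrices α = [[1/2, −4], [1/4, 0]] and β = [[1/2, −1/4], [4, 0]], and let ᾱ, β̄ be their images in PSL₂(ℝ). Then the homomorphism from the free group on two generators to PSL₂(ℝ) sending the generators to ᾱ and β̄ is injective, and the subgroup of PSL₂(ℝ) generated by ᾱ and β̄ is nondiscrete in the subspace topology. -/

import Mathlib

/-- SL₂(ℝ) topologized as a subspace of the space of 2 × 2 real matrices. -/
noncomputable instance : TopologicalSpace (Matrix.SpecialLinearGroup (Fin 2) ℝ) :=
  TopologicalSpace.induced (fun g => (g : Matrix (Fin 2) (Fin 2) ℝ)) inferInstance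

/-- PSL₂(ℝ): the quotient of SL₂(ℝ) by its center {±I}, with the quotient topology. -/
abbrev PSL2R : Type :=
  Matrix.SpecialLinearGroup (Fin 2) ℝ ⧸ Subgroup.center (Matrix.SpecialLinearGroup (Fin 2) ℝ)

/-- The matrix α = [[1/2, −4], [1/4, 0]], as an element of SL₂(ℝ). -/
noncomputable def alphaSL : Matrix.SpecialLinearGroup (Fin 2) ℝ :=
  ⟨!![(1/2 : ℝ), -4; 1/4, 0], by norm_num [Matrix.det_fin_two_of]⟩

/-- The matrix β = [[1/2, −1/4], [4, 0]], as an element of SL₂(ℝ). -/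
noncomputable def betaSL : Matrix.SpecialLinearGroup (Fin 2) ℝ :=
  ⟨!![(1/2 : ℝ), -1/4; 4, 0], by norm_num [Matrix.det_fin_two_of]⟩

open scoped Pointwise Function MatrixGroups
open Filter Topology

/-- A group acting on an additive group by automorphisms acts on its nonzero elements. -/
instance nonzeroMulAction {G A : Type*} [Group G] [AddMonoid A] [DistribMulAction G A] :
    MulAction G {v : A // v ≠ 0} where
  smul g v := ⟨g • v.1, (smul_ne_zero_iff_ne g).2 v.2⟩
  one_smul v := Subtype.ext (one_smul G v.1)
  mul_smul g h v := Subtype.ext (mul_smul g h v.1)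

/-- The matrix α over ℚ. -/
def alphaRat : SL(2, ℚ) := ⟨!![1/2, -4; 1/4, 0], by norm_num [Matrix.det_fin_two_of]⟩

/-- The matrix β over ℚ. -/
def betaRat : SL(2, ℚ) := ⟨!![1/2, -1/4; 4, 0], by norm_num [Matrix.det_fin_two_of]⟩

theorem padicNorm_two_sub_of_lt {a b : ℚ} (h : padicNorm 2 b < padicNorm 2 a) :
    padicNorm 2 (a - b) = padicNorm 2 a := by
  rw [sub_eq_add_neg, padicNorm.add_eq_max_of_ne (by rw [padicNorm.neg]; exact h.ne'),
    padicNorm.neg, max_eq_left h.le]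

theorem padicNorm_two_sub_of_ne {a b : ℚ} (h : padicNorm 2 a ≠ padicNorm 2 b) :
    padicNorm 2 (a - b) = max (padicNorm 2 a) (padicNorm 2 b) := by
  rw [sub_eq_add_neg, padicNorm.add_eq_max_of_ne (by rwa [padicNorm.neg]), padicNorm.neg]

theorem padicNorm_two_two_mul (a : ℚ) : padicNorm 2 (2 * a) = padicNorm 2 a / 2 := by
  have h : padicNorm 2 (2 : ℚ) = 2⁻¹ := by
    simpa using padicNorm.padicNorm_p (p := 2) one_lt_two
  rw [padicNorm.mul, h]
  ring

theorem padicNorm_two_four_mul (a : ℚ) : padicNorm 2 (4 * a) = padicNorm 2 a / 4 := by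
  rw [show 4 * a = 2 * (2 * a) by ring, padicNorm_two_two_mul, padicNorm_two_two_mul]
  ring

theorem padicNorm_two_div_two (a : ℚ) : padicNorm 2 (a / 2) = 2 * padicNorm 2 a := by
  have h := padicNorm_two_two_mul (a / 2)
  rw [mul_div_cancel₀ a two_ne_zero] at h
  linarith

theorem padicNorm_two_div_four (a : ℚ) : padicNorm 2 (a / 4) = 4 * padicNorm 2 a := by
  have h := padicNorm_two_four_mul (a / 4)
  rw [mul_div_cancel₀ a four_ne_zero] at h
  linarith

/-- The neighbourhoods of the 2-adic attracting directions of α (`true`) and β (`false`). -/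
def attractingSet (i : Bool) : Set {v : Fin 2 → ℚ // v ≠ 0} :=
  if i then {v | 2 * padicNorm 2 (v.1 0) = padicNorm 2 (v.1 1)}
  else {v | 8 * padicNorm 2 (v.1 1) ≤ padicNorm 2 (v.1 0)}

/-- The neighbourhoods of the 2-adic repelling directions of α (`true`) and β (`false`). -/
def repellingSet (i : Bool) : Set {v : Fin 2 → ℚ // v ≠ 0} :=
  if i then {v | 8 * padicNorm 2 (v.1 0) ≤ padicNorm 2 (v.1 1)}
  else {v | padicNorm 2 (v.1 0) = 2 * padicNorm 2 (v.1 1)}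

theorem padicNorm_two_coord_pos (v : {v : Fin 2 → ℚ // v ≠ 0}) :
    0 < padicNorm 2 (v.1 0) ∨ 0 < padicNorm 2 (v.1 1) := by
  by_contra! h
  have h0 := padicNorm.zero_of_padicNorm_eq_zero (h.1.antisymm (padicNorm.nonneg _))
  have h1 := padicNorm.zero_of_padicNorm_eq_zero (h.2.antisymm (padicNorm.nonneg _))
  exact v.2 (by ext i; fin_cases i <;> assumption)

theorem alphaRat_smul (v : {v : Fin 2 → ℚ // v ≠ 0}) :
    (alphaRat • v).1 = ![v.1 0 / 2 - 4 * v.1 1, v.1 0 / 4] := by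
  change (alphaRat : Matrix (Fin 2) (Fin 2) ℚ).mulVec v.1 = _
  ext i; fin_cases i <;> simp [alphaRat, Matrix.mulVec, dotProduct, Fin.sum_univ_two] <;> ring

theorem betaRat_smul (v : {v : Fin 2 → ℚ // v ≠ 0}) :
    (betaRat • v).1 = ![v.1 0 / 2 - v.1 1 / 4, 4 * v.1 0] := by
  change (betaRat : Matrix (Fin 2) (Fin 2) ℚ).mulVec v.1 = _
  ext i; fin_cases i <;> simp [betaRat, Matrix.mulVec, dotProduct, Fin.sum_univ_two] <;> ring

theorem alphaRat_inv_smul (v : {v : Fin 2 → ℚ // v ≠ 0}) :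
    (alphaRat⁻¹ • v).1 = ![4 * v.1 1, v.1 1 / 2 - v.1 0 / 4] := by
  change ((alphaRat⁻¹ : SL(2, ℚ)) : Matrix (Fin 2) (Fin 2) ℚ).mulVec v.1 = _
  rw [Matrix.SpecialLinearGroup.coe_inv, Matrix.adjugate_fin_two]
  ext i; fin_cases i <;> simp [alphaRat, Matrix.mulVec, dotProduct, Fin.sum_univ_two] <;> ring

theorem betaRat_inv_smul (v : {v : Fin 2 → ℚ // v ≠ 0}) :
    (betaRat⁻¹ • v).1 = ![v.1 1 / 4, v.1 1 / 2 - 4 * v.1 0] := by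
  change ((betaRat⁻¹ : SL(2, ℚ)) : Matrix (Fin 2) (Fin 2) ℚ).mulVec v.1 = _
  rw [Matrix.SpecialLinearGroup.coe_inv, Matrix.adjugate_fin_two]
  ext i; fin_cases i <;> simp [betaRat, Matrix.mulVec, dotProduct, Fin.sum_univ_two] <;> ring

/-- Ping-pong on the nonzero vectors of ℚ², with respect to the 2-adic norm. -/
theorem lift_alphaRat_betaRat_injective :
    Function.Injective (FreeGroup.lift fun i : Bool => if i then alphaRat else betaRat) := by
  refine FreeGroup.injective_lift_of_ping_pong _ attractingSet repellingSet ?_ ?_ ?_ ?_ ?_ ?_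
  · rintro (_ | _)
    · exact ⟨⟨![1, 0], by simp⟩, by simp [attractingSet]⟩
    · refine ⟨⟨![2 * 1, 1], by simp⟩, ?_⟩
      change 2 * padicNorm 2 (2 * 1) = padicNorm 2 1
      rw [padicNorm_two_two_mul]
      ring
  · rintro (_ | _) (_ | _) h <;> first | exact absurd rfl h | skip
    all_goals
      refine Set.disjoint_left.2 fun v h₁ h₂ => ?_
      simp only [attractingSet, if_true, Bool.false_eq_true, if_false, Set.mem_ofPred_eq] at h₁ h₂
      rcases padicNorm_two_coord_pos v with h | h <;> linarith
  · rintro (_ | _) (_ | _) h <;> first | exact absurd rfl h | skip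
    all_goals
      refine Set.disjoint_left.2 fun v h₁ h₂ => ?_
      simp only [repellingSet, if_true, Bool.false_eq_true, if_false, Set.mem_ofPred_eq] at h₁ h₂
      rcases padicNorm_two_coord_pos v with h | h <;> linarith
  · rintro (_ | _) (_ | _)
    all_goals
      refine Set.disjoint_left.2 fun v h₁ h₂ => ?_
      simp only [attractingSet, repellingSet, if_true, Bool.false_eq_true, if_false,
        Set.mem_ofPred_eq] at h₁ h₂
      rcases padicNorm_two_coord_pos v with h | h <;> linarith
  · rintro (_ | _) _ ⟨v, hv, rfl⟩
    · change padicNorm 2 (v.1 0) ≠ 2 * padicNorm 2 (v.1 1) at hv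
      change 8 * padicNorm 2 ((betaRat • v).1 1) ≤ padicNorm 2 ((betaRat • v).1 0)
      have h : padicNorm 2 (v.1 0 / 2) ≠ padicNorm 2 (v.1 1 / 4) := by
        rw [padicNorm_two_div_two, padicNorm_two_div_four]
        exact fun h => hv (by linarith)
      rw [betaRat_smul]
      change 8 * padicNorm 2 (4 * v.1 0) ≤ padicNorm 2 (v.1 0 / 2 - v.1 1 / 4)
      rw [padicNorm_two_sub_of_ne h, padicNorm_two_four_mul]
      refine le_trans (le_of_eq ?_) (le_max_left _ _)
      rw [padicNorm_two_div_two]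
      ring
    · change ¬ 8 * padicNorm 2 (v.1 0) ≤ padicNorm 2 (v.1 1) at hv
      change 2 * padicNorm 2 ((alphaRat • v).1 0) = padicNorm 2 ((alphaRat • v).1 1)
      have h : padicNorm 2 (4 * v.1 1) < padicNorm 2 (v.1 0 / 2) := by
        rw [padicNorm_two_div_two, padicNorm_two_four_mul]
        linarith
      rw [alphaRat_smul]
      change 2 * padicNorm 2 (v.1 0 / 2 - 4 * v.1 1) = padicNorm 2 (v.1 0 / 4)
      rw [padicNorm_two_sub_of_lt h, padicNorm_two_div_two, padicNorm_two_div_four]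
      ring
  · rintro (_ | _) _ ⟨v, hv, rfl⟩
    · change ¬ 8 * padicNorm 2 (v.1 1) ≤ padicNorm 2 (v.1 0) at hv
      change padicNorm 2 ((betaRat⁻¹ • v).1 0) = 2 * padicNorm 2 ((betaRat⁻¹ • v).1 1)
      have h : padicNorm 2 (4 * v.1 0) < padicNorm 2 (v.1 1 / 2) := by
        rw [padicNorm_two_div_two, padicNorm_two_four_mul]
        linarith
      rw [betaRat_inv_smul]
      change padicNorm 2 (v.1 1 / 4) = 2 * padicNorm 2 (v.1 1 / 2 - 4 * v.1 0)
      rw [padicNorm_two_sub_of_lt h, padicNorm_two_div_two, padicNorm_two_div_four]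
      ring
    · change 2 * padicNorm 2 (v.1 0) ≠ padicNorm 2 (v.1 1) at hv
      change 8 * padicNorm 2 ((alphaRat⁻¹ • v).1 0) ≤ padicNorm 2 ((alphaRat⁻¹ • v).1 1)
      have h : padicNorm 2 (v.1 1 / 2) ≠ padicNorm 2 (v.1 0 / 4) := by
        rw [padicNorm_two_div_two, padicNorm_two_div_four]
        exact fun h => hv (by linarith)
      rw [alphaRat_inv_smul]
      change 8 * padicNorm 2 (4 * v.1 1) ≤ padicNorm 2 (v.1 1 / 2 - v.1 0 / 4)
      rw [padicNorm_two_sub_of_ne h, padicNorm_two_four_mul]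
      refine le_trans (le_of_eq ?_) (le_max_left _ _)
      rw [padicNorm_two_div_two]
      ring

theorem lift_alphaSL_betaSL_injective :
    Function.Injective (FreeGroup.lift fun i : Bool => if i then alphaSL else betaSL) := by
  have hmap : Function.Injective
      (Matrix.SpecialLinearGroup.map (n := Fin 2) (algebraMap ℚ ℝ)) := by
    intro A B h
    ext i j
    have hij := congrArg (fun M : SL(2, ℝ) => M i j) h
    exact (algebraMap ℚ ℝ).injective hij
  have hcomp : (FreeGroup.lift fun i : Bool => if i then alphaSL else betaSL) =
      (Matrix.SpecialLinearGroup.map (algebraMap ℚ ℝ)).comp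
        (FreeGroup.lift fun i : Bool => if i then alphaRat else betaRat) := by
    ext i j k
    rw [MonoidHom.comp_apply, Matrix.SpecialLinearGroup.map_apply_coe]
    cases i <;> fin_cases j <;> fin_cases k <;> simp [alphaSL, betaSL, alphaRat, betaRat]
  rw [hcomp]
  exact hmap.comp lift_alphaRat_betaRat_injective

theorem sq_eq_one_of_mem_center {A : SL(2, ℝ)} (hA : A ∈ Subgroup.center SL(2, ℝ)) :
    A ^ 2 = 1 := by
  obtain ⟨r, hr, hrA⟩ := Matrix.SpecialLinearGroup.mem_center_iff.1 hA
  apply Subtype.ext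
  rw [Fintype.card_fin] at hr
  rw [Matrix.SpecialLinearGroup.coe_pow, ← hrA, ← map_pow, hr, map_one]
  rfl

theorem lift_mk_alphaSL_betaSL_injective :
    Function.Injective
      (FreeGroup.lift fun i : Bool =>
        if i then (QuotientGroup.mk alphaSL : PSL2R) else (QuotientGroup.mk betaSL : PSL2R)) := by
  have hcomp : (FreeGroup.lift fun i : Bool =>
        if i then (QuotientGroup.mk alphaSL : PSL2R) else (QuotientGroup.mk betaSL : PSL2R)) =
      (QuotientGroup.mk' (Subgroup.center SL(2, ℝ))).comp
        (FreeGroup.lift fun i : Bool => if i then alphaSL else betaSL) := by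
    ext i
    cases i <;> simp
  rw [hcomp, injective_iff_map_eq_one]
  intro w hw
  have hsq := sq_eq_one_of_mem_center ((QuotientGroup.eq_one_iff _).1 hw)
  rw [← map_pow] at hsq
  have hw2 := (injective_iff_map_eq_one _).1 lift_alphaSL_betaSL_injective _ hsq
  exact (pow_eq_one_iff_left two_ne_zero).1 hw2

/-- α is elliptic: its powers lie in the compact stabilizer of the form `x² - 2xy + 16y²`. -/
theorem exists_alphaSL_pow_eq (n : ℕ) : ∃ a c : ℝ, a ^ 2 - 2 * a * c + 16 * c ^ 2 = 1 ∧
    ((alphaSL ^ n : SL(2, ℝ)) : Matrix (Fin 2) (Fin 2) ℝ) = !![a, -16 * c; c, a - 2 * c] := by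
  induction n with
  | zero => exact ⟨1, 0, by norm_num, by simp [Matrix.one_fin_two]⟩
  | succ n ih =>
    obtain ⟨a, c, h, hn⟩ := ih
    refine ⟨a / 2 - 4 * c, a / 4, by linarith, ?_⟩
    rw [pow_succ, Matrix.SpecialLinearGroup.coe_mul, hn]
    ext i j
    fin_cases i <;> fin_cases j <;> simp [alphaSL, Matrix.mul_apply, Fin.sum_univ_two] <;> ring

theorem abs_alphaSL_pow_apply_le (n : ℕ) (i j : Fin 2) : |(alphaSL ^ n) i j| ≤ 16 := by
  obtain ⟨a, c, h, hn⟩ := exists_alphaSL_pow_eq n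
  have hc : |c| ≤ 1 := abs_le_of_sq_le_sq (by nlinarith [sq_nonneg (a - c)]) zero_le_one
  have hd : |a - c| ≤ 1 := abs_le_of_sq_le_sq (by nlinarith [sq_nonneg c]) zero_le_one
  rw [abs_le] at hc hd
  rw [hn, abs_le]
  fin_cases i <;> fin_cases j <;> simp <;> constructor <;> linarith

/-- Some sequence of nontrivial powers of α converges to the identity. -/
theorem exists_alphaSL_pow_tendsto_one : ∃ m : ℕ → ℕ, (∀ k, m k ≠ 0) ∧
    Tendsto (fun k => alphaSL ^ m k) atTop (𝓝 1) := by
  let K : Set (Matrix (Fin 2) (Fin 2) ℝ) :=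
    Set.univ.pi fun _ => Set.univ.pi fun _ => Set.Icc (-16) 16
  have hcompact : IsCompact K :=
    isCompact_univ_pi fun _ => isCompact_univ_pi fun _ => isCompact_Icc
  have : FirstCountableTopology (Matrix (Fin 2) (Fin 2) ℝ) :=
    inferInstanceAs (FirstCountableTopology (Fin 2 → Fin 2 → ℝ))
  obtain ⟨M, -, φ, hφ, hM⟩ := hcompact.tendsto_subseq
    (x := fun n => ((alphaSL ^ n : SL(2, ℝ)) : Matrix (Fin 2) (Fin 2) ℝ))
    fun n i _ j _ => abs_le.1 (abs_alphaSL_pow_apply_le n i j)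
  have hdet : M.det = 1 := by
    have h := (continuous_id.matrix_det.tendsto M).comp hM
    refine tendsto_nhds_unique h (tendsto_const_nhds.congr fun k => ?_)
    exact (alphaSL ^ φ k).2.symm
  refine ⟨fun k => φ (k + 1) - φ k, fun k => (Nat.sub_pos_of_lt (hφ k.lt_succ_self)).ne', ?_⟩
  have hind : IsInducing (fun g : SL(2, ℝ) => (g : Matrix (Fin 2) (Fin 2) ℝ)) := ⟨rfl⟩
  rw [hind.tendsto_nhds_iff]
  have hadj := (continuous_id.matrix_adjugate.tendsto M).comp hM
  have hmul := hadj.mul (hM.comp (tendsto_add_atTop_nat 1))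
  simp only [id, Matrix.adjugate_mul, hdet, one_smul] at hmul
  refine hmul.congr fun k => ?_
  have hsub : alphaSL ^ (φ (k + 1) - φ k) = (alphaSL ^ φ k)⁻¹ * alphaSL ^ φ (k + 1) := by
    rw [eq_inv_mul_iff_mul_eq, ← pow_add, Nat.add_sub_cancel' (hφ k.lt_succ_self).le]
  simp [hsub, Matrix.SpecialLinearGroup.coe_inv]

/-- The images ᾱ, β̄ of α and β in PSL₂(ℝ) generate a free group of rank 2
(the homomorphism from the free group on two generators sending the generators to ᾱ and β̄ is
injective) which is moreover nondiscrete in the subspace topology. -/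
theorem alpha_beta_generate_nondiscrete_free_subgroup :
    Function.Injective
      (FreeGroup.lift fun i : Bool =>
        if i then (QuotientGroup.mk alphaSL : PSL2R) else (QuotientGroup.mk betaSL : PSL2R)) ∧
    ¬ DiscreteTopology
      (Subgroup.closure {(QuotientGroup.mk alphaSL : PSL2R),
        (QuotientGroup.mk betaSL : PSL2R)}) := by
  refine ⟨lift_mk_alphaSL_betaSL_injective, fun hdisc => ?_⟩
  obtain ⟨m, hm, hlim⟩ := exists_alphaSL_pow_tendsto_one
  have hmem (k : ℕ) : (QuotientGroup.mk (alphaSL ^ m k) : PSL2R) ∈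
      Subgroup.closure {(QuotientGroup.mk alphaSL : PSL2R), (QuotientGroup.mk betaSL : PSL2R)} :=
    pow_mem (Subgroup.subset_closure (Set.mem_insert _ _)) (m k)
  have hmk : Continuous (QuotientGroup.mk : SL(2, ℝ) → PSL2R) := continuous_quot_mk
  have htendsto : Tendsto (fun k => (⟨_, hmem k⟩ : Subgroup.closure
      {(QuotientGroup.mk alphaSL : PSL2R), (QuotientGroup.mk betaSL : PSL2R)})) atTop (𝓝 1) :=
    tendsto_subtype_rng.2 ((hmk.tendsto 1).comp hlim)
  rw [nhds_discrete, tendsto_pure] at htendsto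
  obtain ⟨k, hk⟩ := htendsto.exists
  have hk' : (QuotientGroup.mk alphaSL : PSL2R) ^ m k = 1 := congrArg Subtype.val hk
  have hfree : FreeGroup.of true ^ m k = 1 :=
    lift_mk_alphaSL_betaSL_injective (by simpa using hk')
  exact FreeGroup.of_ne_one true ((pow_eq_one_iff_left (hm k)).1 hfree)
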